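/- arXiv:math/0602128 — 2 statements merged into one kernel-verified Lean document; each statement's English description precedes it below -/
import Mathlib

section
/- Let n ≥ 2 and p ≥ 1 be integers with gcd(p, n) = 1, and let Γ be the group with generators a, b and defining relations a² = bⁿ and a² = a bᵖ a bᵖ (the quotient of the free group on a, b by the normal closure of the corresponding relators). Then the element a has order exactly 4p in Γ, the central element γ := a² = bⁿ has order exactly 2p in Γ, and Γ is a finite group of order exactly 4pn. -/
/-- Relators of the group `Γ = ⟨a, b | a² = bⁿ, a² = a bᵖ a bᵖ⟩`, with `a` the generator
`true` and `b` the generator `false`. -/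
def caseVaRelators (n p : ℕ) : Set (FreeGroup Bool) :=
  {FreeGroup.of true ^ 2 * (FreeGroup.of false ^ n)⁻¹,
   FreeGroup.of true ^ 2 *
     (FreeGroup.of true * FreeGroup.of false ^ p *
      FreeGroup.of true * FreeGroup.of false ^ p)⁻¹}

section Relations

variable {G : Type*} [Group G] {a b : G} {n p : ℕ}

lemma conj_zpow_of_rel (h₂ : a ^ 2 = a * b ^ p * a * b ^ p) (i : ℤ) :
    a * b ^ ((p : ℤ) * i) * a⁻¹ = b ^ (-(p : ℤ) * i) := by
  have h : a * b ^ p * a⁻¹ = (b ^ p)⁻¹ := by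
    have h' : a = b ^ p * a * b ^ p := by
      apply mul_left_cancel (a := a)
      simpa [pow_two, mul_assoc] using h₂
    rw [mul_inv_eq_iff_eq_mul, eq_inv_mul_iff_mul_eq, ← mul_assoc]
    exact h'.symm
  rw [zpow_mul, ← conj_zpow, zpow_natCast, h, zpow_mul, zpow_neg, zpow_natCast]

lemma conj_zpow_of_sq_eq (h₁ : a ^ 2 = b ^ n) (i : ℤ) :
    a * b ^ ((n : ℤ) * i) * a⁻¹ = b ^ ((n : ℤ) * i) := by
  rw [zpow_mul, zpow_natCast, ← h₁, ← conj_zpow]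
  congr 1
  group

lemma zpow_eq_one_of_rel (h₁ : a ^ 2 = b ^ n) (h₂ : a ^ 2 = a * b ^ p * a * b ^ p) :
    b ^ (2 * p * n) = 1 := by
  have h := (conj_zpow_of_sq_eq h₁ p).symm.trans
    ((congrArg (fun i : ℤ => a * b ^ i * a⁻¹) (mul_comm _ _)).trans (conj_zpow_of_rel h₂ n))
  rw [← zpow_natCast, show ((2 * p * n : ℕ) : ℤ) = n * p - -p * n by push_cast; ring, zpow_sub, h,
    mul_inv_cancel]

lemma mul_zpow_of_rel (h₁ : a ^ 2 = b ^ n) (h₂ : a ^ 2 = a * b ^ p * a * b ^ p) {u v : ℤ}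
    (huv : p * u + n * v = 1) (i : ℤ) :
    a * b ^ i = b ^ ((n * v - p * u) * i) * a := by
  rw [← mul_inv_eq_iff_eq_mul]
  conv_lhs => rw [show i = p * (u * i) + n * (v * i) by linear_combination -i * huv]
  rw [zpow_add,
    show a * (b ^ (p * (u * i)) * b ^ (n * (v * i))) * a⁻¹ =
      (a * b ^ (p * (u * i)) * a⁻¹) * (a * b ^ (n * (v * i)) * a⁻¹) by group,
    conj_zpow_of_rel h₂, conj_zpow_of_sq_eq h₁, ← zpow_add]
  congr 1
  ring

lemma exists_normal_form (h₁ : a ^ 2 = b ^ n) (h₂ : a ^ 2 = a * b ^ p * a * b ^ p) {u v : ℤ}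
    (huv : p * u + n * v = 1) (hab : Subgroup.closure {a, b} = ⊤) (g : G) :
    ∃ (i : ℤ) (s : Bool), g = b ^ i * a ^ s.toNat := by
  have hb (i j : ℤ) (s : Bool) : ∃ (i' : ℤ) (s' : Bool),
      b ^ j * (b ^ i * a ^ s.toNat) = b ^ i' * a ^ s'.toNat :=
    ⟨j + i, s, by rw [zpow_add, mul_assoc]⟩
  have ha (i : ℤ) (s : Bool) : ∃ (i' : ℤ) (s' : Bool),
      a * (b ^ i * a ^ s.toNat) = b ^ i' * a ^ s'.toNat := by
    rw [← mul_assoc, mul_zpow_of_rel h₁ h₂ huv]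
    cases s with
    | false => exact ⟨(n * v - p * u) * i, true, by simp⟩
    | true =>
      refine ⟨(n * v - p * u) * i + n, false, ?_⟩
      rw [zpow_add, zpow_natCast, ← h₁]
      simp [pow_two, mul_assoc]
  have hinv : a⁻¹ = b ^ (-(n : ℤ)) * a := by
    rw [zpow_neg, zpow_natCast, ← h₁]
    group
  have hg : g ∈ Subgroup.closure {a, b} := hab ▸ Subgroup.mem_top g
  induction hg using Subgroup.closure_induction_left with
  | one => exact ⟨0, false, by simp⟩
  | mul_left x hx y _ ih =>
    obtain ⟨i, s, rfl⟩ := ih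
    rcases hx with rfl | rfl
    · exact ha i s
    · simpa using hb i 1 s
  | inv_mul_cancel x hx y _ ih =>
    obtain ⟨i, s, rfl⟩ := ih
    rcases hx with rfl | rfl
    · obtain ⟨j, t, h⟩ := ha i s
      rw [hinv, mul_assoc, h]
      exact hb j _ t
    · simpa using hb i (-1) s

end Relations

section Model

variable {R : Type*} [CommRing R]

/-- Left multiplication by `b` on normal forms `bⁱ aˢ`, encoded as pairs `(i, s)`. -/
def translatePerm (R : Type*) [CommRing R] : Equiv.Perm (R × Bool) :=
  (Equiv.addLeft (1 : R)).prodCongr (Equiv.refl Bool)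

/-- Left multiplication by `a` on normal forms `bⁱ aˢ`, encoded as pairs `(i, s)`, where
`a b a⁻¹ = bᵏ` and `a² = bᶜ`. -/
def twistPerm (k c : R) (hk : k * k = 1) : Equiv.Perm (R × Bool) where
  toFun x := (k * x.1 + bif x.2 then c else 0, !x.2)
  invFun x := (k * (x.1 - bif x.2 then 0 else c), !x.2)
  left_inv := by
    rintro ⟨i, s⟩
    cases s <;> simp [← mul_assoc, hk]
  right_inv := by
    rintro ⟨i, s⟩
    cases s <;> simp [← mul_assoc, hk]

lemma translatePerm_pow_apply (j : ℕ) (x : R × Bool) :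
    (translatePerm R ^ j) x = (j + x.1, x.2) := by
  induction j with
  | zero => simp
  | succ j ih =>
    rw [pow_succ', Equiv.Perm.mul_apply, ih]
    simp [translatePerm]
    ring

lemma twistPerm_apply (k c : R) (hk : k * k = 1) (x : R × Bool) :
    twistPerm k c hk x = (k * x.1 + bif x.2 then c else 0, !x.2) := rfl

lemma twistPerm_sq {k : R} {n : ℕ} (hk : k * k = 1) (hkn : k * n = n) :
    twistPerm k n hk ^ 2 = translatePerm R ^ n := by
  ext1 ⟨i, s⟩
  rw [pow_two, Equiv.Perm.mul_apply, translatePerm_pow_apply, twistPerm_apply, twistPerm_apply]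
  cases s <;> simp [mul_add, ← mul_assoc, hk, hkn, add_comm]

lemma twistPerm_sq_eq_mul {k c : R} {p : ℕ} (hk : k * k = 1) (hkp : k * p = -p) :
    twistPerm k c hk ^ 2 =
      twistPerm k c hk * translatePerm R ^ p * twistPerm k c hk * translatePerm R ^ p := by
  rw [pow_two, mul_assoc, mul_assoc, mul_right_inj]
  ext1 ⟨i, s⟩
  simp only [Equiv.Perm.mul_apply, translatePerm_pow_apply, twistPerm_apply]
  ext
  · linear_combination -hkp
  · rfl

end Model

section Presentation

variable {n p : ℕ}

lemma caseVaRelators_sq_eq_pow :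
    PresentedGroup.of (rels := caseVaRelators n p) true ^ 2 =
      PresentedGroup.of (rels := caseVaRelators n p) false ^ n :=
  mul_inv_eq_one.mp (PresentedGroup.one_of_mem (rels := caseVaRelators n p) (.inl rfl))

lemma caseVaRelators_sq_eq_mul :
    PresentedGroup.of (rels := caseVaRelators n p) true ^ 2 =
      PresentedGroup.of (rels := caseVaRelators n p) true *
        PresentedGroup.of (rels := caseVaRelators n p) false ^ p *
        PresentedGroup.of (rels := caseVaRelators n p) true *
        PresentedGroup.of (rels := caseVaRelators n p) false ^ p :=
  mul_inv_eq_one.mp (PresentedGroup.one_of_mem (rels := caseVaRelators n p) (.inr rfl))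

lemma caseVaRelators_closure :
    Subgroup.closure {PresentedGroup.of (rels := caseVaRelators n p) true,
      PresentedGroup.of (rels := caseVaRelators n p) false} = ⊤ := by
  rw [← PresentedGroup.closure_range_of]
  congr 1
  ext x
  simp [or_comm]

lemma exists_hom_perm {R : Type*} [CommRing R] {k : R} (hk : k * k = 1) (hkn : k * n = n)
    (hkp : k * p = -p) :
    ∃ φ : PresentedGroup (caseVaRelators n p) →* Equiv.Perm (R × Bool),
      φ (PresentedGroup.of true) = twistPerm k n hk ∧
      φ (PresentedGroup.of false) = translatePerm R := by
  let f : Bool → Equiv.Perm (R × Bool) := fun s => bif s then twistPerm k n hk else translatePerm R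
  have hf : ∀ r ∈ caseVaRelators n p, FreeGroup.lift f r = 1 := by
    rintro r (rfl | rfl)
    · simpa [f, mul_inv_eq_one] using twistPerm_sq hk hkn
    · simpa only [map_mul, map_inv, map_pow, FreeGroup.lift_apply_of, f, cond_true, cond_false,
        mul_inv_eq_one] using twistPerm_sq_eq_mul hk hkp
  exact ⟨PresentedGroup.toGroup hf, PresentedGroup.toGroup.of hf, PresentedGroup.toGroup.of hf⟩

end Presentation

/-- **Step Va of the Rim Theorem (exact orders).** Let `n ≥ 2`, `p ≥ 1` with `gcd(p,n) = 1`,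
and let `Γ = ⟨a, b | a² = bⁿ, a² = a bᵖ a bᵖ⟩`. Then `a` has order exactly `4p` in `Γ`, the
central element `γ = a² = bⁿ` has order exactly `2p`, and `Γ` has order exactly `4pn`. -/
theorem caseVa_orders (n p : ℕ) (hn : 2 ≤ n) (hp : 1 ≤ p) (hgcd : Nat.gcd p n = 1) :
    orderOf (PresentedGroup.of (rels := caseVaRelators n p) true) = 4 * p ∧
    orderOf ((PresentedGroup.of (rels := caseVaRelators n p) true) ^ 2) = 2 * p ∧
    Nat.card (PresentedGroup (caseVaRelators n p)) = 4 * p * n := by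
  obtain ⟨u, v, huv⟩ : ∃ u v : ℤ, p * u + n * v = 1 :=
    ⟨_, _, by rw [← Nat.gcd_eq_gcd_ab, hgcd, Nat.cast_one]⟩
  set a := PresentedGroup.of (rels := caseVaRelators n p) true
  set b := PresentedGroup.of (rels := caseVaRelators n p) false
  have h₁ : a ^ 2 = b ^ n := caseVaRelators_sq_eq_pow
  have h₂ : a ^ 2 = a * b ^ p * a * b ^ p := caseVaRelators_sq_eq_mul
  have hb : b ^ (2 * p * n) = 1 := zpow_eq_one_of_rel h₁ h₂
  have : NeZero (2 * p * n) := ⟨by positivity⟩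
  have hN : (2 * p * n : ZMod (2 * p * n)) = 0 := by
    exact_mod_cast ZMod.natCast_self (2 * p * n)
  have huv' : (p * u + n * v : ZMod (2 * p * n)) = 1 := by
    simpa using congrArg (Int.cast : ℤ → ZMod (2 * p * n)) huv
  obtain ⟨φ, hφa, hφb⟩ := exists_hom_perm (n := n) (p := p)
    (R := ZMod (2 * p * n)) (k := n * v - p * u)
    (by linear_combination (p * u + n * v + 1) * huv' - 2 * u * v * hN)
    (by linear_combination n * huv' - u * hN)
    (by linear_combination -p * huv' + v * hN)
  have hsq : orderOf (a ^ 2) = 2 * p := by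
    refine Nat.dvd_antisymm (orderOf_dvd_of_pow_eq_one ?_) ?_
    · rw [h₁, ← pow_mul, mul_comm, hb]
    · have h := congrArg (fun g => (φ g (0, false)).1) (pow_orderOf_eq_one (a ^ 2))
      rw [h₁, ← pow_mul] at h
      simp only [map_pow, map_one, b, hφb, translatePerm_pow_apply, add_zero,
        Equiv.Perm.one_apply, ZMod.natCast_eq_zero_iff, mul_comm n] at h
      rw [h₁]
      exact Nat.dvd_of_mul_dvd_mul_right (by lia) h
  refine ⟨?_, hsq, ?_⟩
  · have h := orderOf_pow' a two_ne_zero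
    rcases (Nat.dvd_prime Nat.prime_two).mp (Nat.gcd_dvd_right (orderOf a) 2) with h' | h'
    · rw [h', hsq, Nat.div_one] at h
      rw [← h, Nat.gcd_eq_right (dvd_mul_right 2 p)] at h'
      lia
    · have := Nat.div_mul_cancel (h' ▸ Nat.gcd_dvd_left (orderOf a) 2)
      rw [h', hsq] at h
      lia
  · have hf : Function.Bijective
        (fun x : ZMod (2 * p * n) × Bool => b ^ x.1.val * a ^ x.2.toNat) := by
      constructor
      · apply Function.LeftInverse.injective (g := fun g => φ g (0, false))
        rintro ⟨i, s⟩
        simp only [map_mul, map_pow, a, b, hφa, hφb, Equiv.Perm.mul_apply, translatePerm_pow_apply]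
        cases s <;> simp [twistPerm_apply]
      · intro g
        obtain ⟨i, s, rfl⟩ := exists_normal_form h₁ h₂ huv caseVaRelators_closure g
        refine ⟨(i, s), ?_⟩
        simp only [mul_left_inj]
        rw [← zpow_natCast, ZMod.val_intCast, ← zpow_eq_zpow_emod' i hb]
    rw [← Nat.card_eq_of_bijective _ hf, Nat.card_prod, Nat.card_zmod, Nat.card_eq_fintype_card,
      Fintype.card_bool]
    ring
end

section
/- Let n ≥ 2 and p ≥ 1 be integers with gcd(p, n) = 1. Write ζ_h = exp(2πi/h) for a positive integer h. Then there exists u ∈ ℂ with uᵖ = 1 and uⁿ = ζ_p, and for any such u the 2×2 complex matrices A = [[0, ζ_{4p}], [ζ_{4p}, 0]] and B = [[ζ_{2np}, 0], [0, u·ζ_{2np}⁻¹]] satisfy A² = Bⁿ = (A·Bᵖ)² = ζ_{2p}·I₂, where I₂ is the 2×2 identity matrix; moreover A is an invertible matrix of order exactly 4p in GL(2, ℂ). -/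
open Complex

/-- The root of unity `ζ_h = exp(2πi/h)`. -/
noncomputable def zetaRoot (h : ℕ) : ℂ := Complex.exp (2 * Real.pi * Complex.I / h)

theorem isPrimitiveRoot_zetaRoot {h : ℕ} (hh : h ≠ 0) : IsPrimitiveRoot (zetaRoot h) h :=
  Complex.isPrimitiveRoot_exp h hh

theorem zetaRoot_ne_zero (h : ℕ) : zetaRoot h ≠ 0 := Complex.exp_ne_zero _

theorem zetaRoot_mul_pow {k : ℕ} (hk : k ≠ 0) (h : ℕ) : zetaRoot (k * h) ^ k = zetaRoot h := by
  rw [zetaRoot, zetaRoot, ← Complex.exp_nat_mul]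
  congr 1
  have : (k : ℂ) ≠ 0 := by exact_mod_cast hk
  push_cast
  field_simp

theorem zetaRoot_four_mul_sq (p : ℕ) : zetaRoot (4 * p) ^ 2 = zetaRoot (2 * p) := by
  simpa [← mul_assoc] using zetaRoot_mul_pow two_ne_zero (2 * p)

theorem exists_pow_eq_one_and_pow_eq_zetaRoot {n p : ℕ} (hp : p ≠ 0) (hgcd : n.Coprime p) :
    ∃ u : ℂ, u ^ p = 1 ∧ u ^ n = zetaRoot p := by
  have hζ := isPrimitiveRoot_zetaRoot hp
  have : NeZero p := ⟨hp⟩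
  obtain ⟨i, -, hi⟩ := (hζ.pow_of_coprime n hgcd).eq_pow_of_pow_eq_one hζ.pow_eq_one
  refine ⟨zetaRoot p ^ i, ?_, ?_⟩
  · rw [pow_right_comm, hζ.pow_eq_one, one_pow]
  · rw [pow_right_comm, hi]

theorem antidiagonal_sq {R : Type*} [CommRing R] (a b : R) :
    !![0, a; b, 0] ^ 2 = (a * b) • (1 : Matrix (Fin 2) (Fin 2) R) := by
  ext i j
  fin_cases i <;> fin_cases j <;> simp [sq, Matrix.mul_apply, mul_comm]

theorem diagonal_fin_two_pow {R : Type*} [CommRing R] (a b : R) (k : ℕ) :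
    !![a, 0; 0, b] ^ k = !![a ^ k, 0; 0, b ^ k] := by
  induction k with
  | zero => simp [Matrix.one_fin_two]
  | succ k ih => simp [pow_succ, ih]

theorem orderOf_antidiagonal {R : Type*} [CommRing R] [Nontrivial R] {a b : R} {m : ℕ}
    (h : IsPrimitiveRoot (a * b) m) : orderOf !![0, a; b, 0] = 2 * m := by
  have hpow (k : ℕ) :
      !![0, a; b, 0] ^ (2 * k) = (a * b) ^ k • (1 : Matrix (Fin 2) (Fin 2) R) := by
    rw [pow_mul, antidiagonal_sq, smul_pow, one_pow]
  refine Nat.dvd_antisymm ?_ ?_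
  · rw [orderOf_dvd_iff_pow_eq_one, hpow, h.pow_eq_one, one_smul]
  · have hone := pow_orderOf_eq_one !![0, a; b, 0]
    obtain ⟨k, hk | hk⟩ := Nat.even_or_odd' (orderOf !![0, a; b, 0])
    · rw [hk, hpow] at hone
      rw [hk]
      refine Nat.mul_dvd_mul_left 2 (h.dvd_of_pow_eq_one k ?_)
      simpa using congr_fun₂ hone 0 0
    · rw [hk, pow_succ, hpow] at hone
      simpa using congr_fun₂ hone 0 0

/-- **Step Va of the Rim Theorem (matrix representation).** Let `n ≥ 2`, `p ≥ 1` with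
`gcd(p,n) = 1`. Then there exists `u ∈ ℂ` with `uᵖ = 1` and `uⁿ = ζ_p`, and for any such
`u` the matrices `A = [[0, ζ_{4p}], [ζ_{4p}, 0]]` and `B = [[ζ_{2np}, 0], [0, u·ζ_{2np}⁻¹]]`
satisfy `A² = Bⁿ = (A·Bᵖ)² = ζ_{2p}·I₂`; moreover `A` is invertible of order exactly `4p`. -/
theorem caseVa_matrix_representation (n p : ℕ) (hn : 2 ≤ n) (hp : 1 ≤ p)
    (hgcd : Nat.gcd p n = 1) :
    (∃ u : ℂ, u ^ p = 1 ∧ u ^ n = zetaRoot p) ∧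
    ∀ u : ℂ, u ^ p = 1 → u ^ n = zetaRoot p →
      let A : Matrix (Fin 2) (Fin 2) ℂ := !![0, zetaRoot (4 * p); zetaRoot (4 * p), 0]
      let B : Matrix (Fin 2) (Fin 2) ℂ := !![zetaRoot (2 * n * p), 0;
                                             0, u * (zetaRoot (2 * n * p))⁻¹]
      A ^ 2 = zetaRoot (2 * p) • (1 : Matrix (Fin 2) (Fin 2) ℂ) ∧
      B ^ n = zetaRoot (2 * p) • (1 : Matrix (Fin 2) (Fin 2) ℂ) ∧
      (A * B ^ p) ^ 2 = zetaRoot (2 * p) • (1 : Matrix (Fin 2) (Fin 2) ℂ) ∧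
      IsUnit A ∧ orderOf A = 4 * p := by
  have hp0 : p ≠ 0 := by lia
  have hn0 : n ≠ 0 := by lia
  refine ⟨exists_pow_eq_one_and_pow_eq_zetaRoot hp0 (Nat.Coprime.symm hgcd), ?_⟩
  intro u hup hun A B
  have hA : zetaRoot (4 * p) * zetaRoot (4 * p) = zetaRoot (2 * p) := by
    rw [← sq, zetaRoot_four_mul_sq]
  have hB : zetaRoot (2 * n * p) ^ n = zetaRoot (2 * p) := by
    rw [← zetaRoot_mul_pow hn0 (2 * p), mul_left_comm, mul_assoc]
  have horder : orderOf A = 4 * p := by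
    have hprim : IsPrimitiveRoot (zetaRoot (4 * p) * zetaRoot (4 * p)) (2 * p) :=
      hA ▸ isPrimitiveRoot_zetaRoot (by lia)
    rw [orderOf_antidiagonal hprim]
    ring
  refine ⟨?_, ?_, ?_, ?_, horder⟩
  · rw [antidiagonal_sq, hA]
  · have hBn : (u * (zetaRoot (2 * n * p))⁻¹) ^ n = zetaRoot (2 * p) := by
      rw [mul_pow, inv_pow, hB, hun, ← zetaRoot_mul_pow two_ne_zero p, sq,
        mul_inv_cancel_right₀ (zetaRoot_ne_zero _)]
    rw [diagonal_fin_two_pow, hB, hBn, Matrix.one_fin_two]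
    simp
  · have hABp : A * B ^ p = !![0, zetaRoot (4 * p) * (zetaRoot (2 * n * p) ^ p)⁻¹;
        zetaRoot (4 * p) * zetaRoot (2 * n * p) ^ p, 0] := by
      simp [A, B, diagonal_fin_two_pow, mul_pow, hup]
    have hz := pow_ne_zero p (zetaRoot_ne_zero (2 * n * p))
    rw [hABp, antidiagonal_sq, mul_mul_mul_comm, inv_mul_cancel₀ hz, mul_one, hA]
  · exact IsUnit.of_pow_eq_one (pow_orderOf_eq_one A) (by lia)
end
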